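/- arXiv:quant-ph/0505090 — 2 statements merged into one kernel-verified Lean document; each statement's English description precedes it below -/
import Mathlib

section
/- (Ozawa's theorem on pure-state-preserving instruments.) For an instrument I with finite outcome set Ω on M_d, the following two statements are equivalent: (a) for every pure state η (rank-one projection) and every outcome ω with p_η(ω) > 0, the a posteriori state π_η(ω) is pure; (b) I_q(η; I) ≥ 0 for every density matrix η, where I_q(η; I) = S_q(η) − Σ_{ω: p_η(ω)>0} p_η(ω) S_q(π_η(ω)) is the quantum information gain. -/
open Matrix Finset
open scoped BigOperators ComplexOrder

noncomputable section

/-- Matrix logarithm of a Hermitian matrix via the spectral decomposition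
(with the convention `Real.log 0 = 0` on the kernel); `0` for non-Hermitian matrices. -/
def matLog {d : ℕ} (A : Matrix (Fin d) (Fin d) ℂ) : Matrix (Fin d) (Fin d) ℂ :=
  if hA : A.IsHermitian then
    (hA.eigenvectorUnitary : Matrix (Fin d) (Fin d) ℂ) *
      Matrix.diagonal (fun i => (Real.log (hA.eigenvalues i) : ℂ)) *
      star (hA.eigenvectorUnitary : Matrix (Fin d) (Fin d) ℂ)
  else 0

/-- The von Neumann entropy `S_q(ρ) = −Tr(ρ log ρ)`. -/
def vnEntropy {d : ℕ} (ρ : Matrix (Fin d) (Fin d) ℂ) : ℝ :=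
  -(Matrix.trace (ρ * matLog ρ)).re

/-- The quantum relative entropy `S_q(ρ‖φ) = Tr(ρ (log ρ − log φ))`. -/
def qRelEntropy {d : ℕ} (ρ φ : Matrix (Fin d) (Fin d) ℂ) : ℝ :=
  (Matrix.trace (ρ * (matLog ρ - matLog φ))).re

/-- The classical relative entropy `S_c(p‖q) = Σ_{ω : p ω > 0} p ω log (p ω / q ω)`. -/
def cRelEntropy {Ω : Type*} [Fintype Ω] (p q : Ω → ℝ) : ℝ :=
  ∑ ω ∈ Finset.univ.filter (fun ω => 0 < p ω), p ω * Real.log (p ω / q ω)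

/-- The probability of outcome `ω` for POV measure `E` in the state `ρ`. -/
def povProb {d : ℕ} {Ω : Type*} (E : Ω → Matrix (Fin d) (Fin d) ℂ)
    (ρ : Matrix (Fin d) (Fin d) ℂ) (ω : Ω) : ℝ :=
  (Matrix.trace (E ω * ρ)).re

/-- The χ-quantity of the ensemble `{p, σ}` (relative entropies w.r.t. the average state). -/
def chiQuantity {d : ℕ} {X : Type*} [Fintype X] (p : X → ℝ)
    (σ : X → Matrix (Fin d) (Fin d) ℂ) : ℝ :=
  ∑ x ∈ Finset.univ.filter (fun x => 0 < p x),
    p x * qRelEntropy (σ x) (∑ y, p y • σ y)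

/-- The operation `O(ω)[ρ] = Σ_k V_k^ω ρ (V_k^ω)†` of the instrument with Kraus family `V`. -/
def instrOp {d : ℕ} {Ω K : Type*} [Fintype K] (V : Ω → K → Matrix (Fin d) (Fin d) ℂ)
    (ω : Ω) (ρ : Matrix (Fin d) (Fin d) ℂ) : Matrix (Fin d) (Fin d) ℂ :=
  ∑ k, V ω k * ρ * (V ω k)ᴴ

/-- The POV measure `E(ω) = Σ_k (V_k^ω)† V_k^ω` associated with the instrument `V`. -/
def instrPOV {d : ℕ} {Ω K : Type*} [Fintype K] (V : Ω → K → Matrix (Fin d) (Fin d) ℂ)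
    (ω : Ω) : Matrix (Fin d) (Fin d) ℂ :=
  ∑ k, (V ω k)ᴴ * V ω k

/-- The outcome probability `p_ρ(ω) = Tr(E(ω) ρ)` of the instrument `V`. -/
def outcomeProb {d : ℕ} {Ω K : Type*} [Fintype K] (V : Ω → K → Matrix (Fin d) (Fin d) ℂ)
    (ρ : Matrix (Fin d) (Fin d) ℂ) (ω : Ω) : ℝ :=
  (Matrix.trace (instrPOV V ω * ρ)).re

/-- The a posteriori state `π_ρ(ω) = O(ω)[ρ] / p_ρ(ω)` of the instrument `V`. -/
def postState {d : ℕ} {Ω K : Type*} [Fintype K] (V : Ω → K → Matrix (Fin d) (Fin d) ℂ)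
    (ρ : Matrix (Fin d) (Fin d) ℂ) (ω : Ω) : Matrix (Fin d) (Fin d) ℂ :=
  (outcomeProb V ρ ω)⁻¹ • instrOp V ω ρ

/-- The classical input/output mutual information `I_c{p, ρ; E}` for the ensemble `{p, ρ}`
measured with the POV measure `E`. -/
def mutualInfo {d : ℕ} {A Ω : Type*} [Fintype A] [Fintype Ω]
    (p : A → ℝ) (ρ : A → Matrix (Fin d) (Fin d) ℂ)
    (E : Ω → Matrix (Fin d) (Fin d) ℂ) : ℝ :=
  ∑ x ∈ Finset.univ.filter (fun x : A × Ω => 0 < p x.1 * povProb E (ρ x.1) x.2),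
    (p x.1 * povProb E (ρ x.1) x.2) *
      Real.log ((p x.1 * povProb E (ρ x.1) x.2) /
        (p x.1 * povProb E (∑ α, p α • ρ α) x.2))

/-- The quantum information gain `I_q(ρ; I)` of the instrument `V` on the state `ρ`. -/
def infoGain {d : ℕ} {Ω K : Type*} [Fintype Ω] [Fintype K]
    (V : Ω → K → Matrix (Fin d) (Fin d) ℂ) (ρ : Matrix (Fin d) (Fin d) ℂ) : ℝ :=
  vnEntropy ρ - ∑ ω ∈ Finset.univ.filter (fun ω => 0 < outcomeProb V ρ ω),
    outcomeProb V ρ ω * vnEntropy (postState V ρ ω)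

/-- A pure state: a rank-one orthogonal projection. -/
def IsPureState {d : ℕ} (ρ : Matrix (Fin d) (Fin d) ℂ) : Prop :=
  ρ.IsHermitian ∧ ρ * ρ = ρ ∧ ρ.rank = 1

end

/-- The spectral theorem as an explicit matrix product. -/
lemma isHermitian_eq_conj_diagonal {d : ℕ} {A : Matrix (Fin d) (Fin d) ℂ} (hA : A.IsHermitian) :
    A = (hA.eigenvectorUnitary : Matrix (Fin d) (Fin d) ℂ) *
      diagonal (fun i => (hA.eigenvalues i : ℂ)) *
      (hA.eigenvectorUnitary : Matrix (Fin d) (Fin d) ℂ)ᴴ := by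
  have h := hA.spectral_theorem
  rw [Unitary.conjStarAlgAut_apply] at h
  exact h

lemma conjTranspose_eigenvectorUnitary_mul_self {d : ℕ} {A : Matrix (Fin d) (Fin d) ℂ}
    (hA : A.IsHermitian) :
    (hA.eigenvectorUnitary : Matrix (Fin d) (Fin d) ℂ)ᴴ * hA.eigenvectorUnitary = 1 :=
  Unitary.coe_star_mul_self hA.eigenvectorUnitary

lemma conj_eigenvectorUnitary_eq_diagonal {d : ℕ} {A : Matrix (Fin d) (Fin d) ℂ}
    (hA : A.IsHermitian) :
    (hA.eigenvectorUnitary : Matrix (Fin d) (Fin d) ℂ)ᴴ * A * hA.eigenvectorUnitary =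
      diagonal (fun i => (hA.eigenvalues i : ℂ)) := by
  have hU := conjTranspose_eigenvectorUnitary_mul_self hA
  conv_lhs => enter [1, 2]; rw [isHermitian_eq_conj_diagonal hA]
  simp only [Matrix.mul_assoc, hU, Matrix.mul_one]
  rw [← Matrix.mul_assoc, hU, Matrix.one_mul]

/-- The entropy is the sum of `-λ log λ` over the eigenvalues. -/
lemma vnEntropy_eq_sum_negMulLog {d : ℕ} {A : Matrix (Fin d) (Fin d) ℂ} (hA : A.IsHermitian) :
    vnEntropy A = ∑ i, Real.negMulLog (hA.eigenvalues i) := by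
  have key : (A * matLog A).trace =
      ∑ i, ((hA.eigenvalues i * Real.log (hA.eigenvalues i) : ℝ) : ℂ) := by
    rw [matLog, dif_pos hA, star_eq_conjTranspose, Matrix.mul_assoc, Matrix.trace_mul_comm,
      Matrix.mul_assoc, Matrix.mul_assoc, Matrix.trace_mul_comm, Matrix.mul_assoc,
      conj_eigenvectorUnitary_eq_diagonal hA, diagonal_mul_diagonal,
      trace_diagonal]
    exact Finset.sum_congr rfl fun i _ => by push_cast; ring
  rw [vnEntropy, key, ← Complex.ofReal_sum, Complex.ofReal_re, ← Finset.sum_neg_distrib]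
  exact Finset.sum_congr rfl fun i _ => by rw [Real.negMulLog]; ring

lemma vnEntropy_self_mul_conjTranspose {d : ℕ} (B : Matrix (Fin d) (Fin d) ℂ) :
    vnEntropy (B * Bᴴ) = vnEntropy (Bᴴ * B) := by
  have h₁ := isHermitian_mul_conjTranspose_self B
  have h₂ := isHermitian_conjTranspose_mul_self B
  rw [vnEntropy_eq_sum_negMulLog h₁, vnEntropy_eq_sum_negMulLog h₂,
    (IsHermitian.eigenvalues_eq_eigenvalues_iff h₁ h₂).2 (charpoly_mul_comm _ _)]

lemma self_mul_conjTranspose_apply_self {m n : Type*} [Fintype n] (T : Matrix m n ℂ) (j : m) :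
    (T * Tᴴ) j j = ((∑ i, Complex.normSq (T j i) : ℝ) : ℂ) := by
  simp [Matrix.mul_apply, Complex.mul_conj]

/-- Peierls' inequality: measuring in an orthonormal basis does not decrease the entropy. -/
lemma vnEntropy_le_sum_negMulLog_diag {d : ℕ} {A U : Matrix (Fin d) (Fin d) ℂ}
    (hA : A.PosSemidef) (hU : Uᴴ * U = 1) :
    vnEntropy A ≤ ∑ j, Real.negMulLog ((Uᴴ * A * U) j j).re := by
  set W := (hA.1.eigenvectorUnitary : Matrix (Fin d) (Fin d) ℂ) with hWdef
  set l := hA.1.eigenvalues with hl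
  have hW : Wᴴ * W = 1 := conjTranspose_eigenvectorUnitary_mul_self hA.1
  have hW' : W * Wᴴ = 1 := mul_eq_one_comm.1 hW
  have hU' : U * Uᴴ = 1 := mul_eq_one_comm.1 hU
  set T := Uᴴ * W with hT
  have hrow (j : Fin d) : ∑ i, Complex.normSq (T j i) = 1 := by
    have h := self_mul_conjTranspose_apply_self T j
    rw [hT, conjTranspose_mul, conjTranspose_conjTranspose, Matrix.mul_assoc,
      ← Matrix.mul_assoc W, hW', Matrix.one_mul, hU, one_apply_eq] at h
    exact_mod_cast h.symm
  have hcol (i : Fin d) : ∑ j, Complex.normSq (T j i) = 1 := by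
    have hTT : Tᴴ * Tᴴᴴ = 1 := by
      rw [hT, conjTranspose_conjTranspose, conjTranspose_mul, conjTranspose_conjTranspose,
        Matrix.mul_assoc, ← Matrix.mul_assoc U, hU', Matrix.one_mul, hW]
    have h := self_mul_conjTranspose_apply_self Tᴴ i
    rw [hTT, one_apply_eq] at h
    simp only [conjTranspose_apply, RCLike.star_def, Complex.normSq_conj] at h
    exact_mod_cast h.symm
  have hdiag (j : Fin d) : ((Uᴴ * A * U) j j).re = ∑ i, Complex.normSq (T j i) • l i := by
    have h : Uᴴ * A * U = T * diagonal (fun i => (l i : ℂ)) * Tᴴ := by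
      conv_lhs => rw [isHermitian_eq_conj_diagonal hA.1]
      rw [hT, conjTranspose_mul, conjTranspose_conjTranspose]
      simp only [Matrix.mul_assoc, hWdef, hl]
    rw [h, Matrix.mul_apply, Complex.re_sum]
    refine Finset.sum_congr rfl fun i _ => ?_
    rw [mul_diagonal, conjTranspose_apply, mul_right_comm, RCLike.star_def, Complex.mul_conj,
      ← Complex.ofReal_mul, Complex.ofReal_re, smul_eq_mul]
  calc vnEntropy A = ∑ i, Real.negMulLog (l i) := vnEntropy_eq_sum_negMulLog hA.1
    _ = ∑ i, ∑ j, Complex.normSq (T j i) • Real.negMulLog (l i) := by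
        simp_rw [← Finset.sum_smul, hcol, one_smul]
    _ = ∑ j, ∑ i, Complex.normSq (T j i) • Real.negMulLog (l i) := Finset.sum_comm
    _ ≤ _ := Finset.sum_le_sum fun j _ => by
        rw [hdiag]
        exact Real.concaveOn_negMulLog.le_map_sum (fun i _ => Complex.normSq_nonneg _) (hrow j)
          fun i _ => hA.eigenvalues_nonneg i

/-- Concavity of the von Neumann entropy. -/
lemma sum_mul_vnEntropy_le {d : ℕ} {ι : Type*} (s : Finset ι) (p : ι → ℝ)
    (τ : ι → Matrix (Fin d) (Fin d) ℂ) (hp : ∀ i ∈ s, 0 ≤ p i) (hsum : ∑ i ∈ s, p i = 1)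
    (hτ : ∀ i ∈ s, (τ i).PosSemidef) :
    ∑ i ∈ s, p i * vnEntropy (τ i) ≤ vnEntropy (∑ i ∈ s, p i • τ i) := by
  have hρ : (∑ i ∈ s, p i • τ i).IsHermitian :=
    (posSemidef_sum s fun i hi => (hτ i hi).smul (hp i hi)).1
  set U := (hρ.eigenvectorUnitary : Matrix (Fin d) (Fin d) ℂ) with hUdef
  have hU : Uᴴ * U = 1 := conjTranspose_eigenvectorUnitary_mul_self hρ
  have hl (j : Fin d) : hρ.eigenvalues j = ∑ i ∈ s, p i • ((Uᴴ * τ i * U) j j).re := by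
    have h := congrFun (congrFun (conj_eigenvectorUnitary_eq_diagonal hρ) j) j
    rw [diagonal_apply_eq] at h
    rw [← Complex.ofReal_re (hρ.eigenvalues j), ← h, Finset.mul_sum, Finset.sum_mul,
      Matrix.sum_apply, Complex.re_sum]
    simp [hUdef]
  calc ∑ i ∈ s, p i * vnEntropy (τ i)
      ≤ ∑ i ∈ s, p i * ∑ j, Real.negMulLog ((Uᴴ * τ i * U) j j).re :=
        Finset.sum_le_sum fun i hi => mul_le_mul_of_nonneg_left
          (vnEntropy_le_sum_negMulLog_diag (hτ i hi) hU) (hp i hi)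
    _ = ∑ j, ∑ i ∈ s, p i • Real.negMulLog ((Uᴴ * τ i * U) j j).re := by
        simp_rw [Finset.mul_sum, smul_eq_mul]
        exact Finset.sum_comm
    _ ≤ ∑ j, Real.negMulLog (hρ.eigenvalues j) := Finset.sum_le_sum fun j _ => by
        rw [hl]
        refine Real.concaveOn_negMulLog.le_map_sum hp hsum fun i hi => ?_
        exact (Complex.nonneg_iff.1 ((hτ i hi).conjTranspose_mul_mul_same U).diag_nonneg).1
    _ = _ := (vnEntropy_eq_sum_negMulLog hρ).symm

lemma eigenvalues_le_one {d : ℕ} {ρ : Matrix (Fin d) (Fin d) ℂ} (hρ : ρ.PosSemidef)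
    (htr : ρ.trace = 1) (i : Fin d) : hρ.1.eigenvalues i ≤ 1 := by
  have h : (1 : ℂ) = ∑ j, (hρ.1.eigenvalues j : ℂ) := htr ▸ hρ.1.trace_eq_sum_eigenvalues
  have h' : 1 = ∑ j, hρ.1.eigenvalues j := by exact_mod_cast h
  rw [h']
  exact Finset.single_le_sum (fun j _ => hρ.eigenvalues_nonneg j) (Finset.mem_univ i)

lemma vnEntropy_nonneg {d : ℕ} {ρ : Matrix (Fin d) (Fin d) ℂ} (hρ : ρ.PosSemidef)
    (htr : ρ.trace = 1) : 0 ≤ vnEntropy ρ := by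
  rw [vnEntropy_eq_sum_negMulLog hρ.1]
  exact Finset.sum_nonneg fun i _ =>
    Real.negMulLog_nonneg (hρ.eigenvalues_nonneg i) (eigenvalues_le_one hρ htr i)

lemma eigenvalues_eq_zero_or_one {d : ℕ} {η : Matrix (Fin d) (Fin d) ℂ} (hη : η.IsHermitian)
    (hsq : η * η = η) (i : Fin d) : hη.eigenvalues i = 0 ∨ hη.eigenvalues i = 1 := by
  have hD := conj_eigenvectorUnitary_eq_diagonal hη
  have hU := mul_eq_one_comm.1 (conjTranspose_eigenvectorUnitary_mul_self hη)
  set U := (hη.eigenvectorUnitary : Matrix (Fin d) (Fin d) ℂ)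
  have hdd : diagonal (fun i => (hη.eigenvalues i : ℂ)) *
      diagonal (fun i => (hη.eigenvalues i : ℂ)) =
      diagonal (fun i => (hη.eigenvalues i : ℂ)) := by
    rw [← hD]
    calc Uᴴ * η * U * (Uᴴ * η * U) = Uᴴ * (η * (U * Uᴴ) * η) * U := by
          simp only [Matrix.mul_assoc]
      _ = _ := by rw [hU, Matrix.mul_one, hsq]
  rw [diagonal_mul_diagonal] at hdd
  have h : hη.eigenvalues i * hη.eigenvalues i = hη.eigenvalues i := by
    exact_mod_cast congrFun (diagonal_injective hdd) i
  exact IsIdempotentElem.iff_eq_zero_or_one.1 h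

lemma trace_eq_rank_of_mul_self_eq {d : ℕ} {η : Matrix (Fin d) (Fin d) ℂ} (hη : η.IsHermitian)
    (hsq : η * η = η) : η.trace = η.rank := by
  rw [hη.rank_eq_card_non_zero_eigs, Fintype.card_subtype, hη.trace_eq_sum_eigenvalues,
    ← Finset.sum_boole]
  exact Finset.sum_congr rfl fun i _ => by
    rcases eigenvalues_eq_zero_or_one hη hsq i with h | h <;> simp [h]

lemma isPureState_iff_trace_eq_one {d : ℕ} {η : Matrix (Fin d) (Fin d) ℂ} :
    IsPureState η ↔ η.IsHermitian ∧ η * η = η ∧ η.trace = 1 := by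
  refine and_congr_right fun h₁ => and_congr_right fun h₂ => ?_
  rw [trace_eq_rank_of_mul_self_eq h₁ h₂, Nat.cast_eq_one]

lemma isPureState_of_vnEntropy_eq_zero {d : ℕ} {ρ : Matrix (Fin d) (Fin d) ℂ}
    (hρ : ρ.PosSemidef) (htr : ρ.trace = 1) (hS : vnEntropy ρ = 0) : IsPureState ρ := by
  have hl (i : Fin d) : hρ.1.eigenvalues i = 0 ∨ hρ.1.eigenvalues i = 1 := by
    rw [vnEntropy_eq_sum_negMulLog hρ.1, Finset.sum_eq_zero_iff_of_nonneg fun i _ =>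
      Real.negMulLog_nonneg (hρ.eigenvalues_nonneg i) (eigenvalues_le_one hρ htr i)] at hS
    have h := hS i (Finset.mem_univ i)
    have h0 := hρ.eigenvalues_nonneg i
    simp only [Real.negMulLog, neg_mul, neg_eq_zero, mul_eq_zero, Real.log_eq_zero] at h
    rcases h with h | h | h | h
    · exact Or.inl h
    · exact Or.inl h
    · exact Or.inr h
    · linarith
  refine isPureState_iff_trace_eq_one.2 ⟨hρ.1, ?_, htr⟩
  have hU := conjTranspose_eigenvectorUnitary_mul_self hρ.1
  set U := (hρ.1.eigenvectorUnitary : Matrix (Fin d) (Fin d) ℂ) with hUdef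
  have h := isHermitian_eq_conj_diagonal hρ.1
  rw [← hUdef] at h
  have hD : diagonal (fun i => (hρ.1.eigenvalues i : ℂ)) *
      diagonal (fun i => (hρ.1.eigenvalues i : ℂ)) =
      diagonal (fun i => (hρ.1.eigenvalues i : ℂ)) := by
    rw [diagonal_mul_diagonal]
    congr 1
    ext i
    rcases hl i with h | h <;> simp [h]
  generalize diagonal (fun i => (hρ.1.eigenvalues i : ℂ)) = D at h hD
  calc ρ * ρ = U * (D * (Uᴴ * U) * D) * Uᴴ := by rw [h]; simp only [Matrix.mul_assoc]
    _ = ρ := by rw [hU, Matrix.mul_one, hD, ← h]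

lemma IsPureState.posSemidef {d : ℕ} {η : Matrix (Fin d) (Fin d) ℂ} (h : IsPureState η) :
    η.PosSemidef := by
  have := posSemidef_conjTranspose_mul_self η
  rwa [h.1.eq, h.2.1] at this

lemma IsPureState.vnEntropy_eq_zero {d : ℕ} {η : Matrix (Fin d) (Fin d) ℂ}
    (h : IsPureState η) : vnEntropy η = 0 := by
  rw [vnEntropy_eq_sum_negMulLog h.1]
  exact Finset.sum_eq_zero fun i _ => by
    rcases eigenvalues_eq_zero_or_one h.1 h.2.1 i with h | h <;> simp [h]

lemma IsPureState.exists_eq_vecMulVec {d : ℕ} {η : Matrix (Fin d) (Fin d) ℂ}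
    (h : IsPureState η) : ∃ v : Fin d → ℂ, η = vecMulVec v (star v) := by
  have hr := h.2.2
  rw [h.1.rank_eq_card_non_zero_eigs, Fintype.card_eq_one_iff] at hr
  obtain ⟨⟨i, hi⟩, hu⟩ := hr
  have hl : h.1.eigenvalues = Pi.single i 1 := by
    ext j
    by_cases hj : j = i
    · subst hj
      rw [Pi.single_eq_same]
      exact (eigenvalues_eq_zero_or_one h.1 h.2.1 j).resolve_left hi
    · rw [Pi.single_eq_of_ne hj]
      by_contra hne
      exact hj (congrArg Subtype.val (hu ⟨j, hne⟩))
  refine ⟨fun a => (h.1.eigenvectorUnitary : Matrix (Fin d) (Fin d) ℂ) a i, ?_⟩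
  conv_lhs => rw [isHermitian_eq_conj_diagonal h.1]
  ext a b
  rw [Matrix.mul_apply, Finset.sum_eq_single i]
  · simp [mul_diagonal, hl, vecMulVec_apply]
  · intro j _ hj
    simp [mul_diagonal, hl, Pi.single_eq_of_ne hj]
  · simp

lemma isPureState_smul_vecMulVec {d : ℕ} {x : Fin d → ℂ} {c : ℝ} (hc : 0 < c)
    (hx : star x ⬝ᵥ x = c) : IsPureState (c⁻¹ • vecMulVec x (star x)) := by
  have hc' : (c : ℂ) ≠ 0 := by exact_mod_cast hc.ne'
  refine isPureState_iff_trace_eq_one.2 ⟨?_, ?_, ?_⟩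
  · exact ((posSemidef_vecMulVec_self_star x).smul (inv_nonneg.2 hc.le)).1
  · rw [smul_mul_smul_comm, vecMulVec_mul_vecMulVec, hx]
    ext i j
    simp [vecMulVec_apply]
    field_simp
  · rw [trace_smul, trace_vecMulVec, dotProduct_comm, hx, Complex.real_smul, Complex.ofReal_inv,
      inv_mul_cancel₀ hc']

open scoped MatrixOrder in
lemma Matrix.PosSemidef.exists_eq_self_mul_conjTranspose {d : ℕ}
    {ρ : Matrix (Fin d) (Fin d) ℂ} (hρ : ρ.PosSemidef) :
    ∃ A : Matrix (Fin d) (Fin d) ℂ, ρ = A * Aᴴ := by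
  obtain ⟨B, hB⟩ := CStarAlgebra.nonneg_iff_eq_star_mul_self.mp hρ.nonneg
  exact ⟨Bᴴ, by rw [conjTranspose_conjTranspose]; exact hB⟩

section Instrument

variable {d : ℕ} {Ω K : Type*} [Fintype K] (V : Ω → K → Matrix (Fin d) (Fin d) ℂ) (ω : Ω)

lemma instrOp_smul (c : ℝ) (ρ : Matrix (Fin d) (Fin d) ℂ) :
    instrOp V ω (c • ρ) = c • instrOp V ω ρ := by
  simp [instrOp, Finset.smul_sum]

lemma instrOp_sum {ι : Type*} (s : Finset ι) (ρ : ι → Matrix (Fin d) (Fin d) ℂ) :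
    instrOp V ω (∑ i ∈ s, ρ i) = ∑ i ∈ s, instrOp V ω (ρ i) := by
  simp only [instrOp, Finset.mul_sum, Finset.sum_mul]
  exact Finset.sum_comm

variable {V ω}

lemma posSemidef_instrOp {ρ : Matrix (Fin d) (Fin d) ℂ} (hρ : ρ.PosSemidef) :
    (instrOp V ω ρ).PosSemidef :=
  posSemidef_sum _ fun k _ => hρ.mul_mul_conjTranspose_same (V ω k)

variable (V ω) in
lemma trace_instrOp (ρ : Matrix (Fin d) (Fin d) ℂ) :
    (instrOp V ω ρ).trace = (instrPOV V ω * ρ).trace := by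
  simp only [instrOp, instrPOV, trace_sum, Finset.sum_mul]
  exact Finset.sum_congr rfl fun k _ => by
    rw [Matrix.trace_mul_comm, ← Matrix.mul_assoc]

variable (V ω) in
lemma posSemidef_instrPOV : (instrPOV V ω).PosSemidef :=
  posSemidef_sum _ fun k _ => posSemidef_conjTranspose_mul_self (V ω k)

lemma trace_instrOp_eq_outcomeProb {ρ : Matrix (Fin d) (Fin d) ℂ} (hρ : ρ.PosSemidef) :
    (instrOp V ω ρ).trace = outcomeProb V ρ ω := by
  rw [outcomeProb, ← trace_instrOp]
  exact Complex.eq_re_of_ofReal_le (posSemidef_instrOp hρ).trace_nonneg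

lemma outcomeProb_nonneg {ρ : Matrix (Fin d) (Fin d) ℂ} (hρ : ρ.PosSemidef) :
    0 ≤ outcomeProb V ρ ω := by
  have h := (posSemidef_instrOp (V := V) (ω := ω) hρ).trace_nonneg
  rw [trace_instrOp_eq_outcomeProb hρ] at h
  exact_mod_cast h

lemma posSemidef_postState {ρ : Matrix (Fin d) (Fin d) ℂ} (hρ : ρ.PosSemidef) :
    (postState V ρ ω).PosSemidef :=
  (posSemidef_instrOp hρ).smul (inv_nonneg.2 (outcomeProb_nonneg hρ))

lemma trace_postState {ρ : Matrix (Fin d) (Fin d) ℂ} (hρ : ρ.PosSemidef)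
    (hp : 0 < outcomeProb V ρ ω) : (postState V ρ ω).trace = 1 := by
  rw [postState, trace_smul, trace_instrOp_eq_outcomeProb hρ, Complex.real_smul,
    ← Complex.ofReal_mul, inv_mul_cancel₀ hp.ne', Complex.ofReal_one]

/-- An operation preserving purity maps rank-one matrices `x x†` to matrices `y y†`. -/
lemma exists_instrOp_vecMulVec_eq
    (hpure : ∀ η : Matrix (Fin d) (Fin d) ℂ, IsPureState η → 0 < outcomeProb V η ω →
      IsPureState (postState V η ω)) (x : Fin d → ℂ) :
    ∃ y : Fin d → ℂ, instrOp V ω (vecMulVec x (star x)) = vecMulVec y (star y) := by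
  have hX := posSemidef_vecMulVec_self_star x
  rcases (outcomeProb_nonneg (V := V) (ω := ω) hX).eq_or_lt with hp | hp
  · refine ⟨0, ?_⟩
    have h := trace_instrOp_eq_outcomeProb (V := V) (ω := ω) hX
    rw [← hp, Complex.ofReal_zero, (posSemidef_instrOp hX).trace_eq_zero_iff] at h
    rw [h, zero_vecMulVec]
  · have h0 : (0 : ℂ) ≤ star x ⬝ᵥ x := dotProduct_star_self_nonneg x
    have hc : star x ⬝ᵥ x = ((star x ⬝ᵥ x).re : ℂ) := Complex.eq_re_of_ofReal_le h0
    set c := (star x ⬝ᵥ x).re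
    have hcpos : 0 < c := by
      refine lt_of_le_of_ne (Complex.nonneg_iff.1 h0).1 fun h => ?_
      rw [← h, Complex.ofReal_zero, dotProduct_star_self_eq_zero] at hc
      simp [hc, outcomeProb] at hp
    have hη := isPureState_smul_vecMulVec hcpos hc
    set η := c⁻¹ • vecMulVec x (star x) with hηdef
    have hprob : 0 < outcomeProb V η ω := by
      have : outcomeProb V η ω = c⁻¹ * outcomeProb V (vecMulVec x (star x)) ω := by
        simp [outcomeProb, hηdef]
      rw [this]
      positivity
    obtain ⟨v, hv⟩ := (hpure η hη hprob).exists_eq_vecMulVec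
    set r := c * outcomeProb V η ω with hr
    have hr0 : 0 ≤ r := by positivity
    refine ⟨(Real.sqrt r) • v, ?_⟩
    have h1 : instrOp V ω (vecMulVec x (star x)) = r • postState V η ω := by
      rw [postState, hηdef, instrOp_smul, ← hηdef, smul_smul, smul_smul, hr,
        mul_inv_cancel_right₀ hprob.ne', mul_inv_cancel₀ hcpos.ne', one_smul]
    rw [h1, hv, star_smul, star_trivial (Real.sqrt r), smul_vecMulVec, vecMulVec_smul, smul_smul,
      Real.mul_self_sqrt hr0]

lemma vnEntropy_instrOp_le
    (hpure : ∀ η : Matrix (Fin d) (Fin d) ℂ, IsPureState η → 0 < outcomeProb V η ω →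
      IsPureState (postState V η ω)) (B : Matrix (Fin d) (Fin d) ℂ) :
    vnEntropy (instrOp V ω (B * Bᴴ)) ≤ vnEntropy (Bᴴ * instrPOV V ω * B) := by
  have hτ : (Bᴴ * instrPOV V ω * B).IsHermitian :=
    ((posSemidef_instrPOV V ω).conjTranspose_mul_mul_same B).1
  have hD := conj_eigenvectorUnitary_eq_diagonal hτ
  have hU := mul_eq_one_comm.1 (conjTranspose_eigenvectorUnitary_mul_self hτ)
  set U := (hτ.eigenvectorUnitary : Matrix (Fin d) (Fin d) ℂ)
  set W := B * U with hW
  have hWW : B * Bᴴ = ∑ j, vecMulVec (W.col j) (star (W.col j)) := by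
    have h : B * Bᴴ = W * Wᴴ := by
      rw [hW, conjTranspose_mul, Matrix.mul_assoc, ← Matrix.mul_assoc U, hU, Matrix.one_mul]
    rw [h]
    ext a b
    simp [Matrix.mul_apply, Matrix.sum_apply, vecMulVec_apply]
  choose y hy using fun j => exists_instrOp_vecMulVec_eq hpure (W.col j)
  set Y : Matrix (Fin d) (Fin d) ℂ := of fun a j => y j a with hY
  have hYY : instrOp V ω (B * Bᴴ) = Y * Yᴴ := by
    rw [hWW, instrOp_sum]
    simp_rw [hy]
    ext a b
    simp [Matrix.mul_apply, Matrix.sum_apply, vecMulVec_apply, hY]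
  have hdiag (j : Fin d) : (Yᴴ * Y) j j = hτ.eigenvalues j := by
    have h1 : (Yᴴ * Y) j j = (vecMulVec (y j) (star (y j))).trace := by
      simp [Matrix.mul_apply, trace_vecMulVec, hY, dotProduct, mul_comm]
    have h2 : (Wᴴ * instrPOV V ω * W) j j = hτ.eigenvalues j := by
      rw [hW, conjTranspose_mul]
      simp only [Matrix.mul_assoc] at hD ⊢
      rw [hD, diagonal_apply_eq]
    rw [h1, ← hy, trace_instrOp, mul_vecMulVec, trace_vecMulVec, ← h2, Matrix.mul_assoc,
      Matrix.mul_apply, dotProduct_comm]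
    rfl
  rw [hYY, vnEntropy_self_mul_conjTranspose, vnEntropy_eq_sum_negMulLog hτ]
  refine (vnEntropy_le_sum_negMulLog_diag (posSemidef_conjTranspose_mul_self Y)
    (U := 1) (by simp)).trans_eq ?_
  simp [hdiag]

end Instrument

/-- Ozawa's theorem: an instrument sends every pure state into a.s. pure
a posteriori states iff its quantum information gain is nonnegative on every state. -/
theorem pure_preserving_iff_infoGain_nonneg {d : ℕ} (hd : 1 ≤ d)
    {Ω K : Type*} [Fintype Ω] [Fintype K]
    (V : Ω → K → Matrix (Fin d) (Fin d) ℂ)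
    (hV : ∑ ω, instrPOV V ω = 1) :
    (∀ η : Matrix (Fin d) (Fin d) ℂ, IsPureState η →
        ∀ ω, 0 < outcomeProb V η ω → IsPureState (postState V η ω)) ↔
      (∀ η : Matrix (Fin d) (Fin d) ℂ, η.PosSemidef → η.trace = 1 →
        0 ≤ infoGain V η) := by
  constructor
  · intro hpure ρ hρ htr
    obtain ⟨A, hA⟩ := hρ.exists_eq_self_mul_conjTranspose
    set s := Finset.univ.filter fun ω => 0 < outcomeProb V ρ ω with hs
    set p := outcomeProb V ρ with hp
    have hzero (ω : Ω) (hω : ω ∉ s) : p ω = 0 := by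
      refine le_antisymm (not_lt.1 fun h => hω (by simpa [hs] using h)) (outcomeProb_nonneg hρ)
    have hpsum : ∑ ω ∈ s, p ω = 1 := by
      rw [Finset.sum_subset (Finset.subset_univ s) fun ω _ hω => hzero ω hω]
      simp only [hp, outcomeProb]
      rw [← Complex.re_sum, ← trace_sum, ← Finset.sum_mul, hV, Matrix.one_mul, htr,
        Complex.one_re]
    set τ : Ω → Matrix (Fin d) (Fin d) ℂ :=
      fun ω => (p ω)⁻¹ • (Aᴴ * instrPOV V ω * A) with hτ
    have hpsd (ω : Ω) : (Aᴴ * instrPOV V ω * A).PosSemidef :=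
      (posSemidef_instrPOV V ω).conjTranspose_mul_mul_same A
    have hle (ω : Ω) (hω : ω ∈ s) : vnEntropy (postState V ρ ω) ≤ vnEntropy (τ ω) := by
      have hpos : 0 < p ω := (Finset.mem_filter.1 hω).2
      have hsq : Real.sqrt (p ω)⁻¹ * Real.sqrt (p ω)⁻¹ = (p ω)⁻¹ :=
        Real.mul_self_sqrt (inv_nonneg.2 hpos.le)
      have h := vnEntropy_instrOp_le (fun η hη => hpure η hη ω) (Real.sqrt (p ω)⁻¹ • A)
      rw [conjTranspose_smul, star_trivial, smul_mul_smul_comm, hsq, ← hA, instrOp_smul,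
        Matrix.smul_mul, smul_mul_smul_comm, hsq] at h
      exact h
    have hsum : ∑ ω ∈ s, p ω • τ ω = Aᴴ * A := by
      calc ∑ ω ∈ s, p ω • τ ω = ∑ ω ∈ s, Aᴴ * instrPOV V ω * A :=
            Finset.sum_congr rfl fun ω hω => by
              rw [hτ, smul_smul, mul_inv_cancel₀ (Finset.mem_filter.1 hω).2.ne', one_smul]
        _ = ∑ ω, Aᴴ * instrPOV V ω * A := by
            refine Finset.sum_subset (Finset.subset_univ s) fun ω _ hω => ?_
            rw [← (hpsd ω).trace_eq_zero_iff, Matrix.mul_assoc, Matrix.trace_mul_comm,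
              Matrix.mul_assoc, ← hA, ← trace_instrOp, trace_instrOp_eq_outcomeProb hρ, ← hp,
              hzero ω hω, Complex.ofReal_zero]
        _ = Aᴴ * A := by rw [← Finset.sum_mul, ← Finset.mul_sum, hV, Matrix.mul_one]
    have hconc := sum_mul_vnEntropy_le s p τ
      (fun ω hω => (Finset.mem_filter.1 hω).2.le) hpsum
      fun ω hω => (hpsd ω).smul (inv_nonneg.2 (Finset.mem_filter.1 hω).2.le)
    rw [hsum, ← vnEntropy_self_mul_conjTranspose, ← hA] at hconc
    rw [infoGain, sub_nonneg]
    exact (Finset.sum_le_sum fun ω hω => mul_le_mul_of_nonneg_left (hle ω hω)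
      (Finset.mem_filter.1 hω).2.le).trans hconc
  · intro hgain η hη ω hω
    have hps := hη.posSemidef
    have h := hgain η hps (isPureState_iff_trace_eq_one.1 hη).2.2
    have hS (ω : Ω) (h : 0 < outcomeProb V η ω) : 0 ≤ vnEntropy (postState V η ω) :=
      vnEntropy_nonneg (posSemidef_postState hps) (trace_postState hps h)
    rw [infoGain, hη.vnEntropy_eq_zero, zero_sub, Left.nonneg_neg_iff] at h
    have hnn : ∀ ω ∈ Finset.univ.filter (fun ω => 0 < outcomeProb V η ω),
        0 ≤ outcomeProb V η ω * vnEntropy (postState V η ω) := fun ω hω =>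
      mul_nonneg (Finset.mem_filter.1 hω).2.le (hS ω (Finset.mem_filter.1 hω).2)
    have h0 := (Finset.sum_eq_zero_iff_of_nonneg hnn).1 (le_antisymm h (Finset.sum_nonneg hnn)) ω
      (Finset.mem_filter.2 ⟨Finset.mem_univ ω, hω⟩)
    exact isPureState_of_vnEntropy_eq_zero (posSemidef_postState hps) (trace_postState hps hω)
      ((mul_eq_zero.1 h0).resolve_left hω.ne')
end

section
/- Let {p_i, ρ_i} be an ensemble of letter states on a finite alphabet A with average state η_i, and let I be an instrument with finite outcome set Ω, operations O(ω) and POV measure E. Then I_c{p_i, ρ_i; E} + Σ_{ω: p_f(ω)>0} p_f(ω) χ{p_{i|f}(·|ω), ρ_f^•(ω)} ≥ χ{p_i, η_f^•}, where ρ_f^α(ω) = O(ω)[ρ_i(α)]/p_{f|i}(ω|α), η_f^α = Σ_ω O(ω)[ρ_i(α)] are the a priori final states, and the ensemble {p_i, η_f^•} has average state η_f = Σ_α p_i(α) η_f^α. -/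
open Matrix Finset
open scoped BigOperators ComplexOrder

/-- `A` is diagonalized by the unitary matrix `U` with real eigenvalues `a`. -/
structure DiagonalizedBy {d : ℕ} (A U : Matrix (Fin d) (Fin d) ℂ) (a : Fin d → ℝ) : Prop where
  star_mul : Uᴴ * U = 1
  mul_star : U * Uᴴ = 1
  eq : A = U * Matrix.diagonal (fun i => (a i : ℂ)) * Uᴴ

namespace DiagonalizedBy

variable {d : ℕ} {A B U W : Matrix (Fin d) (Fin d) ℂ} {a b : Fin d → ℝ}

theorem of_isHermitian (hA : A.IsHermitian) :
    DiagonalizedBy A (hA.eigenvectorUnitary : Matrix (Fin d) (Fin d) ℂ) hA.eigenvalues where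
  star_mul := Unitary.coe_star_mul_self hA.eigenvectorUnitary
  mul_star := Unitary.coe_mul_star_self hA.eigenvectorUnitary
  eq := by
    conv_lhs => rw [hA.spectral_theorem]
    rw [Unitary.conjStarAlgAut_apply]
    rfl

theorem smul (h : DiagonalizedBy A U a) (c : ℝ) :
    DiagonalizedBy (c • A) U (fun i => c * a i) where
  star_mul := h.star_mul
  mul_star := h.mul_star
  eq := by
    have : Matrix.diagonal (fun i => ((c * a i : ℝ) : ℂ)) =
        c • Matrix.diagonal (fun i => (a i : ℂ)) := by
      ext i j
      by_cases hij : i = j <;> simp [hij]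
    rw [this, h.eq, Matrix.mul_smul, Matrix.smul_mul]

theorem isHermitian (h : DiagonalizedBy A U a) : A.IsHermitian := by
  rw [h.eq, Matrix.IsHermitian, Matrix.conjTranspose_mul, Matrix.conjTranspose_mul,
    Matrix.diagonal_conjTranspose, Matrix.conjTranspose_conjTranspose, Matrix.mul_assoc]
  congr
  funext i
  simp

/-- A function of a diagonalized matrix does not depend on the chosen diagonalization. -/
theorem map_unique (h : DiagonalizedBy A U a) (h' : DiagonalizedBy A W b) (f : ℝ → ℝ) :
    U * Matrix.diagonal (fun i => (f (a i) : ℂ)) * Uᴴ =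
      W * Matrix.diagonal (fun i => (f (b i) : ℂ)) * Wᴴ := by
  have key : Matrix.diagonal (fun i => (a i : ℂ)) * (Uᴴ * W) =
      (Uᴴ * W) * Matrix.diagonal (fun i => (b i : ℂ)) := by
    have e := h.eq.symm.trans h'.eq
    calc Matrix.diagonal (fun i => (a i : ℂ)) * (Uᴴ * W)
        = (Uᴴ * U) * Matrix.diagonal (fun i => (a i : ℂ)) * (Uᴴ * W) := by
          rw [h.star_mul, Matrix.one_mul]
      _ = Uᴴ * (U * Matrix.diagonal (fun i => (a i : ℂ)) * Uᴴ) * W := by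
          simp only [Matrix.mul_assoc]
      _ = (Uᴴ * W) * Matrix.diagonal (fun i => (b i : ℂ)) * (Wᴴ * W) := by
          rw [e]; simp only [Matrix.mul_assoc]
      _ = _ := by rw [h'.star_mul, Matrix.mul_one]
  have key' : Matrix.diagonal (fun i => (f (a i) : ℂ)) * (Uᴴ * W) =
      (Uᴴ * W) * Matrix.diagonal (fun i => (f (b i) : ℂ)) := by
    ext i j
    have e := congrFun (congrFun key i) j
    rw [Matrix.diagonal_mul, Matrix.mul_diagonal] at e ⊢
    by_cases hij : a i = b j
    · rw [hij, mul_comm]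
    · have hz : (Uᴴ * W) i j = 0 := by
        have h0 : ((a i : ℂ) - b j) * (Uᴴ * W) i j = 0 := by linear_combination e
        rcases mul_eq_zero.mp h0 with h1 | h1
        · exact absurd (by exact_mod_cast sub_eq_zero.mp h1) hij
        · exact h1
      simp [hz]
  calc U * Matrix.diagonal (fun i => (f (a i) : ℂ)) * Uᴴ
      = U * (Matrix.diagonal (fun i => (f (a i) : ℂ)) * (Uᴴ * W)) * Wᴴ := by
        simp only [Matrix.mul_assoc, h'.mul_star, Matrix.mul_one]
    _ = (U * Uᴴ) * W * Matrix.diagonal (fun i => (f (b i) : ℂ)) * Wᴴ := by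
        rw [key']; simp only [Matrix.mul_assoc]
    _ = _ := by rw [h.mul_star, Matrix.one_mul]

theorem matLog_eq (h : DiagonalizedBy A U a) :
    matLog A = U * Matrix.diagonal (fun i => (Real.log (a i) : ℂ)) * Uᴴ := by
  rw [matLog, dif_pos h.isHermitian]
  exact (of_isHermitian h.isHermitian).map_unique h Real.log

end DiagonalizedBy

section RelativeEntropy

open MeasureTheory intervalIntegral

variable {d : ℕ} {A B U W : Matrix (Fin d) (Fin d) ℂ} {a b : Fin d → ℝ}

theorem trace_diagonal_mul_mul_diagonal_mul_conjTranspose (a b : Fin d → ℝ)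
    (M N : Matrix (Fin d) (Fin d) ℂ) :
    (Matrix.trace (Nᴴ * (Matrix.diagonal (fun i => (a i : ℂ)) * M *
      Matrix.diagonal (fun i => (b i : ℂ))))).re =
      ∑ i, ∑ j, a i * b j * (star (N i j) * M i j).re := by
  rw [Matrix.trace, Complex.re_sum, Finset.sum_comm]
  refine Finset.sum_congr rfl fun j _ => ?_
  rw [Matrix.diag_apply, Matrix.mul_apply, Complex.re_sum]
  refine Finset.sum_congr rfl fun i _ => ?_
  rw [Matrix.mul_diagonal, Matrix.diagonal_mul, Matrix.conjTranspose_apply]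
  simp only [Complex.star_def, Complex.mul_re, Complex.mul_im, Complex.ofReal_re,
    Complex.ofReal_im, Complex.conj_re, Complex.conj_im]
  ring

theorem trace_conj_diagonal_mul_conj_diagonal (a b : Fin d → ℝ)
    (U W : Matrix (Fin d) (Fin d) ℂ) :
    (Matrix.trace ((U * Matrix.diagonal (fun i => (a i : ℂ)) * Uᴴ) *
      (W * Matrix.diagonal (fun i => (b i : ℂ)) * Wᴴ))).re =
      ∑ i, ∑ j, a i * b j * Complex.normSq ((Uᴴ * W) i j) := by
  have := trace_diagonal_mul_mul_diagonal_mul_conjTranspose a b (Uᴴ * W) (Uᴴ * W)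
  have e : Matrix.trace ((U * Matrix.diagonal (fun i => (a i : ℂ)) * Uᴴ) *
      (W * Matrix.diagonal (fun i => (b i : ℂ)) * Wᴴ)) =
      Matrix.trace ((Uᴴ * W)ᴴ * (Matrix.diagonal (fun i => (a i : ℂ)) * (Uᴴ * W) *
      Matrix.diagonal (fun i => (b i : ℂ)))) := by
    rw [Matrix.trace_mul_comm (Uᴴ * W)ᴴ, Matrix.conjTranspose_mul,
      Matrix.conjTranspose_conjTranspose, ← Matrix.mul_assoc _ Wᴴ U, Matrix.trace_mul_comm _ U]
    simp only [Matrix.mul_assoc]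
  rw [e, this]
  refine Finset.sum_congr rfl fun i _ => Finset.sum_congr rfl fun j _ => ?_
  rw [Complex.star_def, ← Complex.normSq_eq_conj_mul_self, Complex.ofReal_re]

theorem DiagonalizedBy.re_trace_left (hA : DiagonalizedBy A U a) (hW : W * Wᴴ = 1) :
    A.trace.re = ∑ i, ∑ j, a i * Complex.normSq ((Uᴴ * W) i j) := by
  have := trace_conj_diagonal_mul_conj_diagonal a (fun _ => 1) U W
  rw [← hA.eq] at this
  simpa [hW] using this

theorem DiagonalizedBy.re_trace_right (hB : DiagonalizedBy B W b) (hU : U * Uᴴ = 1) :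
    B.trace.re = ∑ i, ∑ j, b j * Complex.normSq ((Uᴴ * W) i j) := by
  have := trace_conj_diagonal_mul_conj_diagonal (fun _ => 1) b U W
  rw [← hB.eq] at this
  simpa [hU] using this

theorem qRelEntropy_eq_sum (hA : DiagonalizedBy A U a) (hB : DiagonalizedBy B W b) :
    qRelEntropy A B =
      ∑ i, ∑ j, a i * (Real.log (a i) - Real.log (b j)) *
        Complex.normSq ((Uᴴ * W) i j) := by
  have hAA : DiagonalizedBy (A * matLog A) U (fun i => a i * Real.log (a i)) := by
    refine ⟨hA.star_mul, hA.mul_star, ?_⟩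
    rw [hA.matLog_eq]
    nth_rewrite 1 [hA.eq]
    calc U * Matrix.diagonal (fun i => (a i : ℂ)) * Uᴴ *
          (U * Matrix.diagonal (fun i => (Real.log (a i) : ℂ)) * Uᴴ)
        = U * Matrix.diagonal (fun i => (a i : ℂ)) * (Uᴴ * U) *
          Matrix.diagonal (fun i => (Real.log (a i) : ℂ)) * Uᴴ := by
          simp only [Matrix.mul_assoc]
      _ = _ := by
          rw [hA.star_mul, Matrix.mul_one, Matrix.mul_assoc U, Matrix.diagonal_mul_diagonal]
          simp only [Complex.ofReal_mul]
  have h1 := hAA.re_trace_left hB.mul_star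
  have h2 := trace_conj_diagonal_mul_conj_diagonal a (fun j => Real.log (b j)) U W
  rw [← hA.eq, ← hB.matLog_eq] at h2
  rw [qRelEntropy, Matrix.mul_sub, Matrix.trace_sub, Complex.sub_re, h1, h2,
    ← Finset.sum_sub_distrib]
  refine Finset.sum_congr rfl fun i _ => ?_
  rw [← Finset.sum_sub_distrib]
  exact Finset.sum_congr rfl fun j _ => by ring

/-- The concave quadratic form whose maximum over `X` represents the integrand of the
relative entropy. -/
noncomputable def entropyForm {d : ℕ} (s : ℝ) (A B X : Matrix (Fin d) (Fin d) ℂ) : ℝ :=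
  2 * (Matrix.trace (Xᴴ * (A - B))).re -
    (s * (Matrix.trace (Xᴴ * (A * X))).re + (1 - s) * (Matrix.trace (Xᴴ * (X * B))).re)

theorem entropyForm_sum {Ω : Type*} [Fintype Ω] (s : ℝ)
    (A B : Ω → Matrix (Fin d) (Fin d) ℂ) (X : Matrix (Fin d) (Fin d) ℂ) :
    entropyForm s (∑ ω, A ω) (∑ ω, B ω) X = ∑ ω, entropyForm s (A ω) (B ω) X := by
  simp only [entropyForm, Finset.sum_sub_distrib, Finset.sum_add_distrib, ← Finset.mul_sum,
    ← Complex.re_sum, ← Matrix.trace_sum, ← Matrix.sum_mul]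

theorem entropyForm_eq_sum (hA : DiagonalizedBy A U a) (hB : DiagonalizedBy B W b) (s : ℝ)
    (Y : Matrix (Fin d) (Fin d) ℂ) :
    entropyForm s A B (U * Y * Wᴴ) =
      ∑ i, ∑ j, (2 * (a i - b j) * (star (Y i j) * (Uᴴ * W) i j).re -
        (s * a i + (1 - s) * b j) * Complex.normSq (Y i j)) := by
  set a' := Matrix.diagonal (fun i => (a i : ℂ)) with ha'
  set b' := Matrix.diagonal (fun i => (b i : ℂ)) with hb'
  have eA : Matrix.trace ((U * Y * Wᴴ)ᴴ * A) = Matrix.trace (Yᴴ * (a' * (Uᴴ * W))) := by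
    rw [hA.eq]
    calc _ = Matrix.trace (W * (Yᴴ * (Uᴴ * U) * a' * Uᴴ)) := by
          simp only [Matrix.mul_assoc, Matrix.conjTranspose_mul,
            Matrix.conjTranspose_conjTranspose, ha']
      _ = _ := by
          rw [hA.star_mul, Matrix.trace_mul_comm]
          simp only [Matrix.mul_assoc, Matrix.mul_one]
  have eB : Matrix.trace ((U * Y * Wᴴ)ᴴ * B) = Matrix.trace (Yᴴ * ((Uᴴ * W) * b')) := by
    rw [hB.eq]
    calc _ = Matrix.trace (W * (Yᴴ * Uᴴ * W * b' * Wᴴ)) := by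
          simp only [Matrix.mul_assoc, Matrix.conjTranspose_mul,
            Matrix.conjTranspose_conjTranspose, hb']
      _ = Matrix.trace (Yᴴ * Uᴴ * W * b' * (Wᴴ * W)) := by
          rw [Matrix.trace_mul_comm]; simp only [Matrix.mul_assoc]
      _ = _ := by
          rw [hB.star_mul]
          simp only [Matrix.mul_assoc, Matrix.mul_one]
  have eAX : Matrix.trace ((U * Y * Wᴴ)ᴴ * (A * (U * Y * Wᴴ))) =
      Matrix.trace (Yᴴ * (a' * Y)) := by
    rw [hA.eq]
    calc _ = Matrix.trace (W * (Yᴴ * (Uᴴ * U) * a' * (Uᴴ * U) * Y * Wᴴ)) := by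
          simp only [Matrix.mul_assoc, Matrix.conjTranspose_mul,
            Matrix.conjTranspose_conjTranspose, ha']
      _ = Matrix.trace (Yᴴ * (Uᴴ * U) * a' * (Uᴴ * U) * Y * (Wᴴ * W)) := by
          rw [Matrix.trace_mul_comm]; simp only [Matrix.mul_assoc]
      _ = _ := by
          rw [hA.star_mul, hB.star_mul]
          simp only [Matrix.mul_assoc, Matrix.mul_one]
  have eXB : Matrix.trace ((U * Y * Wᴴ)ᴴ * ((U * Y * Wᴴ) * B)) =
      Matrix.trace (Yᴴ * (Y * b')) := by
    rw [hB.eq]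
    calc _ = Matrix.trace (W * (Yᴴ * (Uᴴ * U) * Y * (Wᴴ * W) * b' * Wᴴ)) := by
          simp only [Matrix.mul_assoc, Matrix.conjTranspose_mul,
            Matrix.conjTranspose_conjTranspose, hb']
      _ = Matrix.trace (Yᴴ * (Uᴴ * U) * Y * (Wᴴ * W) * b' * (Wᴴ * W)) := by
          rw [Matrix.trace_mul_comm]; simp only [Matrix.mul_assoc]
      _ = _ := by
          rw [hA.star_mul, hB.star_mul]
          simp only [Matrix.mul_assoc, Matrix.mul_one]
  have one_eq : Matrix.diagonal (fun _ : Fin d => (((1 : ℝ)) : ℂ)) = 1 := by simp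
  have fA := trace_diagonal_mul_mul_diagonal_mul_conjTranspose a (fun _ => 1) (Uᴴ * W) Y
  have fB := trace_diagonal_mul_mul_diagonal_mul_conjTranspose (fun _ => 1) b (Uᴴ * W) Y
  have fAX := trace_diagonal_mul_mul_diagonal_mul_conjTranspose a (fun _ => 1) Y Y
  have fXB := trace_diagonal_mul_mul_diagonal_mul_conjTranspose (fun _ => 1) b Y Y
  rw [one_eq, Matrix.mul_one] at fA fAX
  rw [one_eq, Matrix.one_mul] at fB fXB
  rw [entropyForm, Matrix.mul_sub, Matrix.trace_sub, Complex.sub_re, eA, eB, eAX, eXB, fA, fB,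
    fAX, fXB]
  simp only [Finset.mul_sum, ← Finset.sum_sub_distrib, ← Finset.sum_add_distrib]
  refine Finset.sum_congr rfl fun i _ => Finset.sum_congr rfl fun j _ => ?_
  have : (star (Y i j) * Y i j).re = Complex.normSq (Y i j) := by
    rw [Complex.star_def, ← Complex.normSq_eq_conj_mul_self, Complex.ofReal_re]
  rw [this]
  ring

/-- The maximum of `entropyForm s A B` in terms of diagonalizations of `A` and `B`. -/
noncomputable def entropyFormMax {d : ℕ} (s : ℝ) (a b : Fin d → ℝ)
    (M : Matrix (Fin d) (Fin d) ℂ) : ℝ :=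
  ∑ i, ∑ j, (a i - b j) ^ 2 / (s * a i + (1 - s) * b j) * Complex.normSq (M i j)

theorem entropyForm_le_max (hA : DiagonalizedBy A U a) (hB : DiagonalizedBy B W b)
    (ha : ∀ i, 0 ≤ a i) (hb : ∀ i, 0 ≤ b i) {s : ℝ} (hs0 : 0 < s) (hs1 : s < 1)
    (X : Matrix (Fin d) (Fin d) ℂ) :
    entropyForm s A B X ≤ entropyFormMax s a b (Uᴴ * W) := by
  have hX : X = U * (Uᴴ * X * W) * Wᴴ := by
    calc X = (U * Uᴴ) * X * (W * Wᴴ) := by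
          rw [hA.mul_star, hB.mul_star, Matrix.one_mul, Matrix.mul_one]
      _ = _ := by simp only [Matrix.mul_assoc]
  rw [hX, entropyForm_eq_sum hA hB, entropyFormMax]
  refine Finset.sum_le_sum fun i _ => Finset.sum_le_sum fun j _ => ?_
  generalize (Uᴴ * X * W) i j = y
  generalize (Uᴴ * W) i j = m
  have h1 : 0 ≤ s * a i := mul_nonneg hs0.le (ha i)
  have h2 : 0 ≤ (1 - s) * b j := mul_nonneg (by linarith) (hb j)
  rcases (add_nonneg h1 h2).eq_or_lt with h | h
  · have ha0 : a i = 0 := by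
      have : s * a i = 0 := by linarith
      simpa [hs0.ne'] using this
    have hb0 : b j = 0 := by
      have : (1 - s) * b j = 0 := by linarith
      simpa [(sub_pos.mpr hs1).ne'] using this
    simp [ha0, hb0]
  · set c := s * a i + (1 - s) * b j
    rw [div_mul_eq_mul_div, le_div_iff₀ h]
    simp only [Complex.normSq_apply, Complex.star_def, Complex.mul_re, Complex.conj_re,
      Complex.conj_im]
    nlinarith [sq_nonneg ((a i - b j) * m.re - c * y.re),
      sq_nonneg ((a i - b j) * m.im - c * y.im)]

theorem exists_entropyForm_eq_max (hA : DiagonalizedBy A U a) (hB : DiagonalizedBy B W b)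
    (s : ℝ) : ∃ X, entropyForm s A B X = entropyFormMax s a b (Uᴴ * W) := by
  refine ⟨U * (Matrix.of fun i j =>
    (((a i - b j) / (s * a i + (1 - s) * b j) : ℝ) : ℂ) * (Uᴴ * W) i j) * Wᴴ, ?_⟩
  rw [entropyForm_eq_sum hA hB, entropyFormMax]
  refine Finset.sum_congr rfl fun i _ => Finset.sum_congr rfl fun j _ => ?_
  rw [Matrix.of_apply]
  generalize (Uᴴ * W) i j = m
  generalize s * a i + (1 - s) * b j = c
  generalize a i - b j = e
  simp only [Complex.normSq_apply, Complex.star_def, Complex.mul_re, Complex.mul_im,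
    Complex.conj_re, Complex.conj_im, Complex.ofReal_re, Complex.ofReal_im]
  by_cases hc : c = 0
  · simp [hc]
  · field_simp
    ring


theorem intervalIntegrable_fun_sum {ι : Type*} (t : Finset ι) {f : ι → ℝ → ℝ} {x y : ℝ}
    (h : ∀ i ∈ t, IntervalIntegrable (f i) volume x y) :
    IntervalIntegrable (fun s => ∑ i ∈ t, f i s) volume x y := by
  simpa only [Finset.sum_fn] using IntervalIntegrable.sum t h

/-- Taylor's formula with integral remainder for `x ↦ x * log x`, in homogeneous form. -/
theorem integral_entropyKernel {a b : ℝ} (ha : 0 ≤ a) (hb : 0 ≤ b) (hab : b = 0 → a = 0) :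
    IntervalIntegrable (fun s => (1 - s) * ((a - b) ^ 2 / (s * a + (1 - s) * b))) volume 0 1 ∧
    ∫ s in (0 : ℝ)..1, (1 - s) * ((a - b) ^ 2 / (s * a + (1 - s) * b)) =
      a * (Real.log a - Real.log b) - a + b := by
  rcases hb.eq_or_lt with hb0 | hb0
  · have ha0 := hab hb0.symm
    simp [← hb0, ha0]
  rcases ha.eq_or_lt with ha0 | ha0
  · subst ha0
    have hcongr : Set.EqOn (fun _ : ℝ => b)
        (fun s => (1 - s) * ((0 - b) ^ 2 / (s * 0 + (1 - s) * b))) (Set.uIoo 0 1) := by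
      intro s hs
      rw [Set.uIoo_of_le zero_le_one] at hs
      have : 1 - s ≠ 0 := by linarith [hs.2]
      have := hb0.ne'
      simp only [mul_zero, zero_add, zero_sub]
      field_simp
    refine ⟨(intervalIntegrable_const (c := b)).congr_uIoo hcongr, ?_⟩
    rw [← intervalIntegral.integral_congr_uIoo hcongr]
    simp
  have hpos : ∀ s ∈ Set.uIcc (0 : ℝ) 1, 0 < s * a + (1 - s) * b := by
    intro s hs
    rw [Set.uIcc_of_le zero_le_one] at hs
    rcases hs.1.eq_or_lt with h | h
    · simp [← h, hb0]
    · have := mul_pos h ha0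
      have := mul_nonneg (sub_nonneg.mpr hs.2) hb
      linarith
  have hcont : IntervalIntegrable
      (fun s => (1 - s) * ((a - b) ^ 2 / (s * a + (1 - s) * b))) volume 0 1 := by
    apply ContinuousOn.intervalIntegrable
    apply ContinuousOn.mul (by fun_prop)
    exact ContinuousOn.div (by fun_prop) (by fun_prop) fun s hs => (hpos s hs).ne'
  refine ⟨hcont, ?_⟩
  rw [integral_eq_sub_of_hasDerivAt
    (f := fun s => (1 - s) * (a - b) * Real.log (s * a + (1 - s) * b) +
      ((s * a + (1 - s) * b) * Real.log (s * a + (1 - s) * b) - (s * a + (1 - s) * b)))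
    ?_ hcont]
  · simp
    ring
  · intro s hs
    have hu := (hpos s hs).ne'
    have h1 : HasDerivAt (fun s : ℝ => 1 - s) (-1) s := by
      simpa using (hasDerivAt_id s).const_sub 1
    have h2 : HasDerivAt (fun s : ℝ => s * a + (1 - s) * b) (a - b) s := by
      refine (((hasDerivAt_id' s).mul_const a).add (h1.mul_const b)).congr_deriv ?_
      ring
    have h3 := h2.log hu
    refine (((h1.mul_const (a - b)).mul h3).add ((h2.mul h3).sub h2)).congr_deriv ?_
    generalize s * a + (1 - s) * b = u at hu
    field_simp
    ring

theorem mul_normSq_eq_zero_of_eigenvalue_eq_zero (hA : DiagonalizedBy A U a)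
    (hB : DiagonalizedBy B W b) (ha : ∀ i, 0 ≤ a i) {c : ℝ} (h : (c • B - A).PosSemidef)
    {j : Fin d} (hj : b j = 0) (i : Fin d) :
    a i * Complex.normSq ((Uᴴ * W) i j) = 0 := by
  have h1 := (h.conjTranspose_mul_mul_same W).diag_nonneg (i := j)
  have e : Wᴴ * (c • B - A) * W = c • Matrix.diagonal (fun i => (b i : ℂ)) -
      (Uᴴ * W)ᴴ * (Matrix.diagonal (fun i => (a i : ℂ)) * (Uᴴ * W)) := by
    rw [Matrix.mul_sub, Matrix.sub_mul, hB.eq, hA.eq, Matrix.mul_smul, Matrix.smul_mul]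
    congr 1
    · congr 1
      calc _ = (Wᴴ * W) * Matrix.diagonal (fun i => (b i : ℂ)) * (Wᴴ * W) := by
            simp only [Matrix.mul_assoc]
        _ = _ := by rw [hB.star_mul, Matrix.one_mul, Matrix.mul_one]
    · simp only [Matrix.mul_assoc, Matrix.conjTranspose_mul, Matrix.conjTranspose_conjTranspose]
  rw [e, Matrix.sub_apply, Matrix.smul_apply, Matrix.diagonal_apply_eq, hj, Matrix.mul_apply] at h1
  have h2 := (Complex.le_def.mp h1).1
  have e2 : ∀ i, ((Uᴴ * W)ᴴ j i * (Matrix.diagonal (fun i => (a i : ℂ)) * (Uᴴ * W)) i j).re =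
      a i * Complex.normSq ((Uᴴ * W) i j) := by
    intro i
    rw [Matrix.diagonal_mul, Matrix.conjTranspose_apply, Complex.normSq_apply]
    simp only [Complex.star_def, Complex.mul_re, Complex.mul_im, Complex.ofReal_re,
      Complex.ofReal_im, Complex.conj_re, Complex.conj_im]
    ring
  simp only [Complex.ofReal_zero, smul_zero, zero_sub, Complex.neg_re, Complex.re_sum, e2,
    Complex.zero_re] at h2
  have hnn : ∀ k ∈ Finset.univ, 0 ≤ a k * Complex.normSq ((Uᴴ * W) k j) :=
    fun k _ => mul_nonneg (ha k) (Complex.normSq_nonneg _)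
  have hz : ∑ k, a k * Complex.normSq ((Uᴴ * W) k j) = 0 :=
    le_antisymm (by linarith) (Finset.sum_nonneg hnn)
  exact (Finset.sum_eq_zero_iff_of_nonneg hnn).mp hz i (Finset.mem_univ i)

theorem integral_entropyFormMax (hA : DiagonalizedBy A U a) (hB : DiagonalizedBy B W b)
    (ha : ∀ i, 0 ≤ a i) (hb : ∀ i, 0 ≤ b i) {c : ℝ} (h : (c • B - A).PosSemidef) :
    IntervalIntegrable (fun s => (1 - s) * entropyFormMax s a b (Uᴴ * W)) volume 0 1 ∧
    ∫ s in (0 : ℝ)..1, (1 - s) * entropyFormMax s a b (Uᴴ * W) =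
      qRelEntropy A B - A.trace.re + B.trace.re := by
  set M := Uᴴ * W with hM
  have term : ∀ i j, IntervalIntegrable (fun s => (1 - s) *
        ((a i - b j) ^ 2 / (s * a i + (1 - s) * b j)) * Complex.normSq (M i j)) volume 0 1 ∧
      ∫ s in (0 : ℝ)..1, (1 - s) *
        ((a i - b j) ^ 2 / (s * a i + (1 - s) * b j)) * Complex.normSq (M i j) =
      (a i * (Real.log (a i) - Real.log (b j)) - a i + b j) * Complex.normSq (M i j) := by
    intro i j
    by_cases hm : Complex.normSq (M i j) = 0
    · simp [hm]
    · have := integral_entropyKernel (ha i) (hb j) fun hj =>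
        (mul_eq_zero.mp (mul_normSq_eq_zero_of_eigenvalue_eq_zero hA hB ha h hj i)).resolve_right hm
      exact ⟨this.1.mul_const _, by rw [intervalIntegral.integral_mul_const, this.2]⟩
  have e : (fun s : ℝ => (1 - s) * entropyFormMax s a b M) = fun s => ∑ i, ∑ j, (1 - s) *
      ((a i - b j) ^ 2 / (s * a i + (1 - s) * b j)) * Complex.normSq (M i j) := by
    funext s
    simp only [entropyFormMax, Finset.mul_sum, mul_assoc]
  have int1 : ∀ i, IntervalIntegrable (fun s => ∑ j, (1 - s) *
      ((a i - b j) ^ 2 / (s * a i + (1 - s) * b j)) * Complex.normSq (M i j)) volume 0 1 := by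
    intro i
    exact intervalIntegrable_fun_sum Finset.univ fun j _ => (term i j).1
  rw [e]
  refine ⟨intervalIntegrable_fun_sum Finset.univ fun i _ => int1 i, ?_⟩
  rw [intervalIntegral.integral_finsetSum fun i _ => int1 i, qRelEntropy_eq_sum hA hB,
    hA.re_trace_left hB.mul_star, hB.re_trace_right hA.mul_star, ← Finset.sum_sub_distrib,
    ← Finset.sum_add_distrib]
  refine Finset.sum_congr rfl fun i _ => ?_
  rw [intervalIntegral.integral_finsetSum fun j _ => (term i j).1, ← Finset.sum_sub_distrib,
    ← Finset.sum_add_distrib]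
  refine Finset.sum_congr rfl fun j _ => ?_
  rw [(term i j).2]
  ring

/-- Subadditivity (equivalently, joint convexity) of the quantum relative entropy. -/
theorem qRelEntropy_sum_le {Ω : Type*} [Fintype Ω] {A B : Ω → Matrix (Fin d) (Fin d) ℂ}
    (hA : ∀ ω, (A ω).PosSemidef) (hB : ∀ ω, (B ω).PosSemidef) {c : ℝ}
    (h : ∀ ω, (c • B ω - A ω).PosSemidef) :
    qRelEntropy (∑ ω, A ω) (∑ ω, B ω) ≤ ∑ ω, qRelEntropy (A ω) (B ω) := by
  have hAs : (∑ ω, A ω).PosSemidef := Matrix.posSemidef_sum _ fun ω _ => hA ω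
  have hBs : (∑ ω, B ω).PosSemidef := Matrix.posSemidef_sum _ fun ω _ => hB ω
  have hs : (c • (∑ ω, B ω) - ∑ ω, A ω).PosSemidef := by
    rw [Finset.smul_sum, ← Finset.sum_sub_distrib]
    exact Matrix.posSemidef_sum _ fun ω _ => h ω
  have dA := fun ω => DiagonalizedBy.of_isHermitian (hA ω).isHermitian
  have dB := fun ω => DiagonalizedBy.of_isHermitian (hB ω).isHermitian
  have dAs := DiagonalizedBy.of_isHermitian hAs.isHermitian
  have dBs := DiagonalizedBy.of_isHermitian hBs.isHermitian
  obtain ⟨is, es⟩ := integral_entropyFormMax dAs dBs hAs.eigenvalues_nonneg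
    hBs.eigenvalues_nonneg hs
  have ht := fun ω => integral_entropyFormMax (dA ω) (dB ω) (hA ω).eigenvalues_nonneg
    (hB ω).eigenvalues_nonneg (h ω)
  have mono := intervalIntegral.integral_mono_on_of_le_Ioo zero_le_one is
    (intervalIntegrable_fun_sum Finset.univ fun ω _ => (ht ω).1) fun s hs => by
      rw [← Finset.mul_sum]
      refine mul_le_mul_of_nonneg_left ?_ (by linarith [hs.2])
      obtain ⟨X, hX⟩ := exists_entropyForm_eq_max dAs dBs s
      rw [← hX, entropyForm_sum]
      exact Finset.sum_le_sum fun ω _ => entropyForm_le_max (dA ω) (dB ω)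
        (hA ω).eigenvalues_nonneg (hB ω).eigenvalues_nonneg hs.1 hs.2 X
  rw [intervalIntegral.integral_finsetSum fun ω _ => (ht ω).1, es] at mono
  simp only [fun ω => (ht ω).2, Finset.sum_add_distrib, Finset.sum_sub_distrib,
    Matrix.trace_sum, Complex.re_sum] at mono
  linarith

theorem qRelEntropy_smul_smul (hA : A.PosSemidef) (hB : B.PosSemidef) {c : ℝ}
    (h : (c • B - A).PosSemidef) {r t : ℝ} (hr : 0 < r) (ht : 0 < t) :
    qRelEntropy (r • A) (t • B) = r * qRelEntropy A B + r * Real.log (r / t) * A.trace.re := by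
  have dA := DiagonalizedBy.of_isHermitian hA.isHermitian
  have dB := DiagonalizedBy.of_isHermitian hB.isHermitian
  rw [qRelEntropy_eq_sum (dA.smul r) (dB.smul t), qRelEntropy_eq_sum dA dB,
    dA.re_trace_left dB.mul_star, Finset.mul_sum, Finset.mul_sum, ← Finset.sum_add_distrib]
  refine Finset.sum_congr rfl fun i _ => ?_
  rw [Finset.mul_sum, Finset.mul_sum, ← Finset.sum_add_distrib]
  refine Finset.sum_congr rfl fun j _ => ?_
  have hz := mul_normSq_eq_zero_of_eigenvalue_eq_zero dA dB hA.eigenvalues_nonneg h (j := j)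
  by_cases hj : hB.isHermitian.eigenvalues j = 0
  · have := hz hj i
    linear_combination (r * (Real.log (r * hA.isHermitian.eigenvalues i) -
      Real.log (t * hB.isHermitian.eigenvalues j)) -
      r * (Real.log (hA.isHermitian.eigenvalues i) -
      Real.log (hB.isHermitian.eigenvalues j)) - r * Real.log (r / t)) * this
  by_cases hi : hA.isHermitian.eigenvalues i = 0
  · simp [hi]
  rw [Real.log_mul hr.ne' hi, Real.log_mul ht.ne' hj, Real.log_div hr.ne' ht.ne']
  ring

theorem qRelEntropy_zero_left (B : Matrix (Fin d) (Fin d) ℂ) : qRelEntropy 0 B = 0 := by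
  simp [qRelEntropy]

end RelativeEntropy

section Instrument

variable {d : ℕ} {A Ω K : Type*} [Fintype A] [Fintype K]

theorem instrOp_posSemidef (V : Ω → K → Matrix (Fin d) (Fin d) ℂ) (ω : Ω)
    {ρ : Matrix (Fin d) (Fin d) ℂ} (hρ : ρ.PosSemidef) : (instrOp V ω ρ).PosSemidef :=
  Matrix.posSemidef_sum _ fun k _ => hρ.mul_mul_conjTranspose_same (V ω k)

theorem outcomeProb_eq_re_trace_instrOp (V : Ω → K → Matrix (Fin d) (Fin d) ℂ)
    (ρ : Matrix (Fin d) (Fin d) ℂ) (ω : Ω) :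
    outcomeProb V ρ ω = (instrOp V ω ρ).trace.re := by
  rw [outcomeProb, instrPOV, instrOp, Matrix.sum_mul, Matrix.trace_sum, Matrix.trace_sum]
  congr 1
  refine Finset.sum_congr rfl fun k _ => ?_
  rw [Matrix.trace_mul_comm (V ω k * ρ), Matrix.mul_assoc]

theorem outcomeProb_sum_smul (V : Ω → K → Matrix (Fin d) (Fin d) ℂ) (p : A → ℝ)
    (ρ : A → Matrix (Fin d) (Fin d) ℂ) (ω : Ω) :
    outcomeProb V (∑ α, p α • ρ α) ω = ∑ α, p α * outcomeProb V (ρ α) ω := by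
  simp [outcomeProb, Matrix.mul_sum, Matrix.trace_sum, Matrix.trace_smul]

theorem posSemidef_inv_smul_sum_sub {p : A → ℝ} (hp : ∀ α, 0 ≤ p α)
    {σ : A → Matrix (Fin d) (Fin d) ℂ} (hσ : ∀ α, (σ α).PosSemidef) {α : A} (hα : 0 < p α) :
    ((p α)⁻¹ • (∑ β, p β • σ β) - σ α).PosSemidef := by
  classical
  have e : (p α)⁻¹ • (∑ β, p β • σ β) - σ α =
      (p α)⁻¹ • ∑ β ∈ Finset.univ.erase α, p β • σ β := by
    rw [← Finset.add_sum_erase _ _ (Finset.mem_univ α), smul_add, smul_smul,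
      inv_mul_cancel₀ hα.ne', one_smul, add_sub_cancel_left]
  rw [e]
  exact (Matrix.posSemidef_sum _ fun β _ => (hσ β).smul (hp β)).smul (inv_nonneg.mpr (hp α))

end Instrument

/-- post-measurement χ-quantity bound involving the a priori final states. -/
theorem apriori_final_chi_bound {d : ℕ} (hd : 1 ≤ d)
    {A Ω K : Type*} [Fintype A] [Fintype Ω] [Fintype K]
    (p : A → ℝ) (hp : ∀ α, 0 ≤ p α) (hp1 : ∑ α, p α = 1)
    (ρ : A → Matrix (Fin d) (Fin d) ℂ)
    (hρ : ∀ α, (ρ α).PosSemidef) (hρtr : ∀ α, (ρ α).trace = 1)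
    (V : Ω → K → Matrix (Fin d) (Fin d) ℂ)
    (hV : ∑ ω, instrPOV V ω = 1) :
    let η := ∑ α, p α • ρ α
    let pf := fun ω => outcomeProb V η ω
    let pfi := fun ω α => outcomeProb V (ρ α) ω
    let ρf := fun α ω => (pfi ω α)⁻¹ • instrOp V ω (ρ α)
    let ηf := fun α => ∑ ω, instrOp V ω (ρ α)
    mutualInfo p ρ (instrPOV V) +
        ∑ ω ∈ Finset.univ.filter (fun ω => 0 < pf ω),
          pf ω * chiQuantity (fun α => p α * pfi ω α / pf ω) (fun α => ρf α ω) ≥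
      chiQuantity p ηf := by
  intro η pf pfi ρf ηf
  have hσ : ∀ α ω, (instrOp V ω (ρ α)).PosSemidef := fun α ω => instrOp_posSemidef V ω (hρ α)
  set τ : Ω → Matrix (Fin d) (Fin d) ℂ := fun ω => ∑ α, p α • instrOp V ω (ρ α) with hτ
  have hτpos : ∀ ω, (τ ω).PosSemidef :=
    fun ω => Matrix.posSemidef_sum _ fun α _ => (hσ α ω).smul (hp α)
  have hle : ∀ α ω, 0 < p α → ((p α)⁻¹ • τ ω - instrOp V ω (ρ α)).PosSemidef :=
    fun α ω hα => posSemidef_inv_smul_sum_sub hp (fun β => hσ β ω) hα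
  have hpfi : ∀ ω α, pfi ω α = (instrOp V ω (ρ α)).trace.re :=
    fun ω α => outcomeProb_eq_re_trace_instrOp V (ρ α) ω
  have hpfi0 : ∀ ω α, 0 ≤ pfi ω α := fun ω α => by
    rw [hpfi]
    exact (Complex.le_def.mp (hσ α ω).trace_nonneg).1
  have hzero : ∀ ω α, pfi ω α = 0 → instrOp V ω (ρ α) = 0 := fun ω α h => by
    rw [hpfi] at h
    refine (hσ α ω).trace_eq_zero_iff.mp (Complex.ext h ?_)
    exact (Complex.le_def.mp (hσ α ω).trace_nonneg).2.symm
  have hpf : ∀ ω, pf ω = ∑ α, p α * pfi ω α := fun ω => outcomeProb_sum_smul V p ρ ω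
  have hpf_pos : ∀ α ω, 0 < p α * pfi ω α → 0 < pf ω := fun α ω h => by
    rw [hpf]
    exact h.trans_le (Finset.single_le_sum (f := fun α => p α * pfi ω α)
      (fun β _ => mul_nonneg (hp β) (hpfi0 ω β)) (Finset.mem_univ α))
  have havg : ∀ ω, ∑ α, (p α * pfi ω α / pf ω) • ρf α ω = (pf ω)⁻¹ • τ ω := fun ω => by
    rw [hτ, Finset.smul_sum]
    refine Finset.sum_congr rfl fun α _ => ?_
    change (p α * pfi ω α / pf ω) • ((pfi ω α)⁻¹ • instrOp V ω (ρ α)) = _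
    by_cases h : pfi ω α = 0
    · simp [hzero ω α h]
    · rw [smul_smul, smul_smul]
      congr 1
      field_simp
  have hterm : ∀ α ω,
      (if 0 < p α * pfi ω α then
        p α * pfi ω α * Real.log (p α * pfi ω α / (p α * pf ω)) else 0) +
      (if 0 < pf ω then pf ω * (if 0 < p α * pfi ω α / pf ω then
        p α * pfi ω α / pf ω * qRelEntropy (ρf α ω) ((pf ω)⁻¹ • τ ω) else 0) else 0) =
      p α * qRelEntropy (instrOp V ω (ρ α)) (τ ω) := by
    intro α ω
    rcases (mul_nonneg (hp α) (hpfi0 ω α)).eq_or_lt with h | h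
    · rw [← h]
      rcases mul_eq_zero.mp h.symm with h' | h'
      · simp [h']
      · simp [hzero ω α h', qRelEntropy_zero_left]
    · have hpα : 0 < p α := (hp α).lt_of_ne fun h0 => by simp [← h0] at h
      have hq : 0 < pfi ω α := (hpfi0 ω α).lt_of_ne fun h0 => by simp [← h0] at h
      have hQ := hpf_pos α ω h
      rw [if_pos h, if_pos hQ, if_pos (div_pos h hQ)]
      change _ + pf ω * (_ * qRelEntropy ((pfi ω α)⁻¹ • instrOp V ω (ρ α)) _) = _
      rw [qRelEntropy_smul_smul (hσ α ω) (hτpos ω) (hle α ω hpα) (inv_pos.mpr hq)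
        (inv_pos.mpr hQ), ← hpfi, mul_div_mul_left _ _ hpα.ne', Real.log_div hq.ne' hQ.ne',
        Real.log_div (inv_pos.mpr hq).ne' (inv_pos.mpr hQ).ne', Real.log_inv, Real.log_inv]
      field_simp
      ring
  have hLHS : mutualInfo p ρ (instrPOV V) + ∑ ω ∈ Finset.univ.filter (fun ω => 0 < pf ω),
      pf ω * chiQuantity (fun α => p α * pfi ω α / pf ω) (fun α => ρf α ω) =
      ∑ α, p α * ∑ ω, qRelEntropy (instrOp V ω (ρ α)) (τ ω) := by
    simp only [Finset.mul_sum, ← hterm, Finset.sum_add_distrib]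
    congr 1
    · rw [mutualInfo, Finset.sum_filter, Fintype.sum_prod_type]
      rfl
    · rw [Finset.sum_filter, Finset.sum_comm]
      refine Finset.sum_congr rfl fun ω _ => ?_
      rw [chiQuantity, havg, Finset.sum_filter]
      split_ifs
      · rw [Finset.mul_sum]
      · simp
  have hηf : ∑ α, p α • ηf α = ∑ ω, τ ω := by
    simp only [ηf, hτ, Finset.smul_sum]
    exact Finset.sum_comm
  rw [hLHS, chiQuantity, hηf, Finset.sum_filter, ge_iff_le]
  refine Finset.sum_le_sum fun α _ => ?_
  split_ifs with hα
  · exact mul_le_mul_of_nonneg_left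
      (qRelEntropy_sum_le (hσ α) hτpos fun ω => hle α ω hα) (hp α)
  · simp [le_antisymm (not_lt.mp hα) (hp α)]
end
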